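/- arXiv:0806.3150 — 2 statements merged into one kernel-verified Lean document; each statement's English description precedes it below -/
import Mathlib

section
/- There exists a constant M > 0 such that for every μ > 0 and every u ∈ H¹(ℝ²) with ‖∇u‖²_{L²} + μ‖u‖²_{L²} ≤ 1, one has ∫_{ℝ²} F(u(x)) dx ≤ M/μ, where F(u) = (1/(8π))(e^{4π|u|²} − 1 − 4π|u|² − 8π²|u|⁴). -/
open MeasureTheory Real Classical
open scoped ENNReal RealInnerProductSpace

noncomputable section

/-- The plane `ℝ²`. -/
abbrev Plane := EuclideanSpace ℝ (Fin 2)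

/-- Pointwise norm of the (full) gradient of `u`. -/
def gradNorm (u : Plane → ℝ) (x : Plane) : ℝ := ‖fderiv ℝ u x‖

/-- The `L^p` norm for a real (finite) exponent `p`. -/
def LpNorm (p : ℝ) (u : Plane → ℝ) : ℝ := (∫ x : Plane, |u x| ^ p) ^ (1 / p)

/-- The sup (`L^∞`) norm. -/
def supNorm (u : Plane → ℝ) : ℝ := ⨆ x : Plane, |u x|

/-- The homogeneous Hölder seminorm `[u]_α`. -/
def holderSemi (α : ℝ) (u : Plane → ℝ) : ℝ :=
  ⨆ p : Plane × Plane,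
    if p.1 = p.2 then 0 else |u p.1 - u p.2| / ‖p.1 - p.2‖ ^ α

/-- The Hölder norm `‖u‖_{C^α} = sup |u| + [u]_α`. -/
def holderNorm (α : ℝ) (u : Plane → ℝ) : ℝ := supNorm u + holderSemi α u

/-- `u` is `α`-Hölder continuous. -/
def IsHolder (α : ℝ) (u : Plane → ℝ) : Prop :=
  ∃ C : ℝ, 0 ≤ C ∧ ∀ x y : Plane, |u x - u y| ≤ C * ‖x - y‖ ^ α

/-- The squared `H¹` norm `‖∇u‖_{L²}² + ‖u‖_{L²}²`. -/
def H1Sq (u : Plane → ℝ) : ℝ :=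
  (∫ x : Plane, gradNorm u x ^ 2) + ∫ x : Plane, u x ^ 2

/-- The squared local `H¹` norm `‖u‖_{H¹[R]}²`. -/
def H1locSq (R : ℝ) (u : Plane → ℝ) : ℝ :=
  ⨆ c : Plane, ∫ x in Metric.closedBall c R, (gradNorm u x ^ 2 + u x ^ 2)

/-- Membership in `H¹(ℝ²)` (with classical derivatives). -/
def MemH1 (u : Plane → ℝ) : Prop :=
  Differentiable ℝ u ∧ Integrable (fun x => u x ^ 2) ∧
    Integrable (fun x => gradNorm u x ^ 2)

/-- The nonlinearity `f(u) = (e^{4π u²} - 1 - 4π u²) u`. -/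
def f (s : ℝ) : ℝ := (Real.exp (4 * π * s ^ 2) - 1 - 4 * π * s ^ 2) * s

/-- The potential `F(u) = (1/8π)(e^{4π u²} - 1 - 4π u² - 8π² u⁴)`. -/
def F (s : ℝ) : ℝ :=
  (8 * π)⁻¹ * (Real.exp (4 * π * s ^ 2) - 1 - 4 * π * s ^ 2 - 8 * π ^ 2 * s ^ 4)

/-- The unit vector of the plane with polar angle `θ`. -/
def unitVec (θ : ℝ) : Plane := !₂[Real.cos θ, Real.sin θ]

theorem norm_unitVec (θ : ℝ) : ‖unitVec θ‖ = 1 := by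
  simp [unitVec, EuclideanSpace.norm_eq]

theorem continuous_unitVec : Continuous unitVec := by
  unfold unitVec
  refine (PiLp.continuous_toLp 2 _).comp (continuous_pi fun i => ?_)
  fin_cases i
  · exact Real.continuous_cos
  · exact Real.continuous_sin

/-- Integration over the plane in polar coordinates. -/
theorem lintegral_plane_polar {g : Plane → ℝ≥0∞} (hg : Measurable g) :
    ∫⁻ x, g x = ∫⁻ θ in Set.Ioo (-π) π, ∫⁻ r in Set.Ioi (0 : ℝ),
      ENNReal.ofReal r * g (r • unitVec θ) := by
  have h1 := (Complex.orthonormalBasisOneI.repr.measurePreserving).lintegral_comp hg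
  rw [← h1, ← Complex.lintegral_comp_polarCoord_symm]
  have h2 : ∀ p : ℝ × ℝ, Complex.orthonormalBasisOneI.repr (Complex.polarCoord.symm p)
      = p.1 • unitVec p.2 := by
    intro p
    ext i
    fin_cases i <;> simp [unitVec, Complex.orthonormalBasisOneI_repr_apply,
      Complex.polarCoord_symm_apply, Complex.cos_ofReal_re, Complex.sin_ofReal_re]
  simp only [h2, smul_eq_mul]
  rw [polarCoord_target, Measure.volume_eq_prod, ← Measure.prod_restrict, lintegral_prod_symm]
  refine Measurable.aemeasurable ?_
  have : Measurable fun p : ℝ × ℝ => p.1 • unitVec p.2 :=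
    (continuous_fst.smul (continuous_unitVec.comp continuous_snd)).measurable
  exact measurable_fst.ennreal_ofReal.mul (hg.comp this)

theorem lintegral_plane_radial {h : ℝ → ℝ≥0∞} (hh : Measurable h) :
    ∫⁻ x : Plane, h ‖x‖ = ENNReal.ofReal (2 * π) * ∫⁻ r in Set.Ioi (0 : ℝ),
      ENNReal.ofReal r * h r := by
  rw [lintegral_plane_polar (g := fun x => h ‖x‖) (hh.comp measurable_norm)]
  have : ∀ θ : ℝ, ∫⁻ r in Set.Ioi (0 : ℝ), ENNReal.ofReal r * h ‖r • unitVec θ‖ =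
      ∫⁻ r in Set.Ioi (0 : ℝ), ENNReal.ofReal r * h r := by
    intro θ
    refine setLIntegral_congr_fun measurableSet_Ioi fun r hr => ?_
    simp [norm_smul, norm_unitVec, abs_of_pos (Set.mem_Ioi.1 hr)]
  simp only [this, setLIntegral_const, Real.volume_Ioo]
  rw [mul_comm]
  congr 2
  ring

theorem lintegral_ball_inv_norm (d : ℝ) :
    ∫⁻ x : Plane, (if ‖x‖ < d then ENNReal.ofReal (1 / ‖x‖) else 0) =
      ENNReal.ofReal (2 * π * d) := by
  have hm : Measurable fun r : ℝ => if r < d then ENNReal.ofReal (1 / r) else 0 :=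
    Measurable.ite measurableSet_Iio (by fun_prop) measurable_const
  rw [lintegral_plane_radial hm]
  have : ∫⁻ r in Set.Ioi (0 : ℝ), ENNReal.ofReal r * (if r < d then ENNReal.ofReal (1 / r) else 0)
      = ∫⁻ r in Set.Ioi (0 : ℝ), (Set.Iio d).indicator 1 r := by
    refine setLIntegral_congr_fun measurableSet_Ioi fun r (hr : 0 < r) => ?_
    by_cases h : r < d
    · simp only [h, if_true, Set.indicator, Set.mem_Iio, Pi.one_apply]
      rw [← ENNReal.ofReal_mul hr.le, mul_one_div_cancel hr.ne', ENNReal.ofReal_one]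
    · simp [h]
  rw [this, lintegral_indicator_one measurableSet_Iio, Measure.restrict_apply measurableSet_Iio,
    Set.inter_comm, Set.Ioi_inter_Iio, Real.volume_Ioo, sub_zero, ← ENNReal.ofReal_mul (by positivity)]

theorem lintegral_annulus_inv_norm_sq {d R : ℝ} (hd : 0 < d) :
    ∫⁻ x : Plane, (if d ≤ ‖x‖ ∧ ‖x‖ < R then ENNReal.ofReal (1 / ‖x‖ ^ 2) else 0) ≤
      ENNReal.ofReal (2 * π * Real.log (R / d)) := by
  have hm : Measurable fun r : ℝ => if d ≤ r ∧ r < R then ENNReal.ofReal (1 / r ^ 2) else 0 :=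
    Measurable.ite measurableSet_Ico (by fun_prop) measurable_const
  rw [lintegral_plane_radial hm, ENNReal.ofReal_mul (p := 2 * π) (by positivity)]
  gcongr
  have : ∫⁻ r in Set.Ioi (0 : ℝ), ENNReal.ofReal r *
      (if d ≤ r ∧ r < R then ENNReal.ofReal (1 / r ^ 2) else 0)
      = ∫⁻ r in Set.Ioi (0 : ℝ), (Set.Ico d R).indicator (fun r => ENNReal.ofReal r⁻¹) r := by
    refine setLIntegral_congr_fun measurableSet_Ioi fun r (hr : 0 < r) => ?_
    by_cases h : d ≤ r ∧ r < R
    · simp only [h, if_true, Set.indicator, Set.mem_Ico, and_self]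
      rw [← ENNReal.ofReal_mul hr.le]
      congr 1
      field_simp
    · simp [h]
  rw [this]
  refine (setLIntegral_le_lintegral _ _).trans ?_
  rw [lintegral_indicator measurableSet_Ico]
  by_cases hR : d ≤ R
  · rw [← integral_inv_of_pos hd (hd.trans_le hR), intervalIntegral.integral_of_le hR,
      ← integral_Ico_eq_integral_Ioc]
    rw [ofReal_integral_eq_lintegral_ofReal]
    · refine (ContinuousOn.integrableOn_Icc ?_).mono_set Set.Ico_subset_Icc_self
      exact continuousOn_inv₀.mono fun x hx => (hd.trans_le hx.1).ne'
    · refine (ae_restrict_mem measurableSet_Ico).mono fun x hx => ?_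
      exact inv_nonneg.2 (hd.trans_le hx.1).le
  · simp [Set.Ico_eq_empty_of_le (not_le.1 hR).le]
/-- The truncated kernel `1 / (2π|y|)` on the ball of radius `R`. -/
def trKernel (R : ℝ) (y : Plane) : ℝ≥0∞ :=
  if ‖y‖ < R then ENNReal.ofReal (1 / (2 * π * ‖y‖)) else 0

theorem measurable_trKernel (R : ℝ) : Measurable (trKernel R) :=
  Measurable.ite (measurableSet_lt measurable_norm measurable_const) (by fun_prop)
    measurable_const

/-- The density `(|∇u|² + κ²u²)^{1/2}`. -/
def energyDensity (κ : ℝ) (u : Plane → ℝ) (y : Plane) : ℝ≥0∞ :=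
  ENNReal.ofReal (√(gradNorm u y ^ 2 + κ ^ 2 * u y ^ 2))

theorem measurable_energyDensity (κ : ℝ) {u : Plane → ℝ} (hu : Differentiable ℝ u) :
    Measurable (energyDensity κ u) := by
  have h1 : Measurable (gradNorm u) := (measurable_fderiv ℝ u).norm
  have h2 : Measurable u := hu.continuous.measurable
  unfold energyDensity
  fun_prop

theorem abs_cos_mul_add_sin_mul_le (t a b g : ℝ) (h : |a| ≤ g) :
    |a * Real.cos t - b * Real.sin t| ≤ √(g ^ 2 + b ^ 2) := by
  apply Real.abs_le_sqrt
  have h1 : a ^ 2 ≤ g ^ 2 := sq_le_sq' (by linarith [neg_abs_le a]) ((le_abs_self a).trans h)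
  nlinarith [sq_nonneg (a * Real.sin t + b * Real.cos t), Real.sin_sq_add_cos_sq t]

theorem ofReal_abs_le_lintegral_ray {κ : ℝ} (hκ : 0 < κ) {u : Plane → ℝ}
    (hu : Differentiable ℝ u) (x : Plane) (θ : ℝ) :
    ENNReal.ofReal |u x| ≤
      ∫⁻ r in Set.Ioo (0 : ℝ) (π / (2 * κ)), energyDensity κ u (x + r • unitVec θ) := by
  set R := π / (2 * κ) with hR
  have hR0 : 0 ≤ R := by positivity
  set g : ℝ → ℝ := fun r => u (x + r • unitVec θ) * Real.cos (κ * r) with hg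
  set g' : ℝ → ℝ := fun r => fderiv ℝ u (x + r • unitVec θ) (unitVec θ) * Real.cos (κ * r) -
    (κ * u (x + r • unitVec θ)) * Real.sin (κ * r) with hg'
  have hd : ∀ r, HasDerivAt g (g' r) r := by
    intro r
    have h1 : HasDerivAt (fun r : ℝ => x + r • unitVec θ) (unitVec θ) r := by
      simpa using ((hasDerivAt_id r).smul_const (unitVec θ)).const_add x
    have h2 := (hu (x + r • unitVec θ)).hasFDerivAt.comp_hasDerivAt r h1
    have h3 : HasDerivAt (fun r : ℝ => Real.cos (κ * r)) (-Real.sin (κ * r) * κ) r := by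
      simpa using ((hasDerivAt_id r).const_mul κ).cos
    convert! h2.mul h3 using 1
    simp only [hg', Function.comp_apply]
    ring
  have hb : ∀ r, ‖g' r‖ₑ ≤ energyDensity κ u (x + r • unitVec θ) := by
    intro r
    rw [← ofReal_norm, energyDensity, Real.norm_eq_abs]
    refine ENNReal.ofReal_le_ofReal ?_
    rw [← mul_pow]
    refine abs_cos_mul_add_sin_mul_le _ _ _ _ ?_
    have := (fderiv ℝ u (x + r • unitVec θ)).le_opNorm (unitVec θ)
    rwa [norm_unitVec, mul_one] at this
  by_cases hfin : ∫⁻ r in Set.Ioo (0 : ℝ) R, energyDensity κ u (x + r • unitVec θ) = ∞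
  · rw [hfin]; exact le_top
  have hmeas : Measurable g' := by
    have : g' = deriv g := funext fun r => (hd r).deriv.symm
    rw [this]; exact measurable_deriv g
  have hlt : ∫⁻ r in Set.Ioo (0 : ℝ) R, ‖g' r‖ₑ ≤
      ∫⁻ r in Set.Ioo (0 : ℝ) R, energyDensity κ u (x + r • unitVec θ) :=
    lintegral_mono fun r => hb r
  have hint : IntervalIntegrable g' volume 0 R := by
    rw [intervalIntegrable_iff_integrableOn_Ioo_of_le hR0]
    exact ⟨hmeas.aestronglyMeasurable, hlt.trans_lt (lt_top_iff_ne_top.2 hfin)⟩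
  have hftc := intervalIntegral.integral_eq_sub_of_hasDerivAt (fun r _ => hd r) hint
  have h0 : g 0 = u x := by simp [hg]
  have h1 : g R = 0 := by
    have : κ * R = π / 2 := by rw [hR]; field_simp
    simp [hg, this]
  rw [h0, h1, zero_sub, intervalIntegral.integral_of_le hR0, integral_Ioc_eq_integral_Ioo] at hftc
  refine le_trans ?_ hlt
  rw [← abs_neg, ← hftc, ← Real.norm_eq_abs, ofReal_norm]
  exact enorm_integral_le_lintegral_enorm _

/-- Pointwise bound of a function by the truncated Riesz potential of its energy density. -/
theorem ofReal_abs_le_lintegral_trKernel {κ : ℝ} (hκ : 0 < κ) {u : Plane → ℝ}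
    (hu : Differentiable ℝ u) (x : Plane) :
    ENNReal.ofReal |u x| ≤
      ∫⁻ y, trKernel (π / (2 * κ)) (y - x) * energyDensity κ u y := by
  set R := π / (2 * κ) with hR
  have hme := measurable_energyDensity κ hu
  have hmk := measurable_trKernel R
  have hshift : ∫⁻ y, trKernel R (y - x) * energyDensity κ u y =
      ∫⁻ z, trKernel R z * energyDensity κ u (x + z) := by
    rw [← lintegral_add_left_eq_self _ x]
    simp
  rw [hshift, lintegral_plane_polar
    (g := fun z => trKernel R z * energyDensity κ u (x + z)) (hmk.mul (hme.comp (measurable_const_add x)))]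
  have hray : ∀ θ : ℝ, ENNReal.ofReal (1 / (2 * π)) * ENNReal.ofReal |u x| ≤
      ∫⁻ r in Set.Ioi (0 : ℝ), ENNReal.ofReal r *
        (trKernel R (r • unitVec θ) * energyDensity κ u (x + r • unitVec θ)) := by
    intro θ
    calc _ ≤ ENNReal.ofReal (1 / (2 * π)) *
          ∫⁻ r in Set.Ioo (0 : ℝ) R, energyDensity κ u (x + r • unitVec θ) := by
            gcongr; exact ofReal_abs_le_lintegral_ray hκ hu x θ
      _ = ∫⁻ r in Set.Ioo (0 : ℝ) R, ENNReal.ofReal (1 / (2 * π)) *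
            energyDensity κ u (x + r • unitVec θ) := by
            rw [lintegral_const_mul' _ _ ENNReal.ofReal_ne_top]
      _ = ∫⁻ r in Set.Ioo (0 : ℝ) R, ENNReal.ofReal r *
        (trKernel R (r • unitVec θ) * energyDensity κ u (x + r • unitVec θ)) := by
            refine setLIntegral_congr_fun measurableSet_Ioo fun r hr => ?_
            have h0 : (0 : ℝ) < r := hr.1
            simp only [trKernel, norm_smul, norm_unitVec, Real.norm_eq_abs, abs_of_pos h0, mul_one,
              hr.2, if_true]
            rw [← mul_assoc, ← ENNReal.ofReal_mul h0.le]
            congr 2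
            field_simp
      _ ≤ _ := lintegral_mono_set Set.Ioo_subset_Ioi_self
  calc ENNReal.ofReal |u x| = ∫⁻ _ in Set.Ioo (-π) π,
        ENNReal.ofReal (1 / (2 * π)) * ENNReal.ofReal |u x| := by
        rw [setLIntegral_const, Real.volume_Ioo, mul_right_comm, ← ENNReal.ofReal_mul (by positivity)]
        have : 1 / (2 * π) * (π - -π) = 1 := by field_simp; ring
        rw [this, ENNReal.ofReal_one, one_mul]
    _ ≤ _ := lintegral_mono fun θ => hray θ
theorem trKernel_mul_trKernel_le {R : ℝ} {z : Plane} (hz : z ≠ 0) (y : Plane) :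
    trKernel R y * trKernel R (y - z) ≤
      ENNReal.ofReal (1 / (4 * π ^ 2 * (‖z‖ / 2))) *
          (if ‖y‖ < ‖z‖ / 2 then ENNReal.ofReal (1 / ‖y‖) else 0) +
      ENNReal.ofReal (1 / (4 * π ^ 2 * (‖z‖ / 2))) *
          (if ‖y - z‖ < ‖z‖ / 2 then ENNReal.ofReal (1 / ‖y - z‖) else 0) +
      (ENNReal.ofReal (1 / (8 * π ^ 2)) *
          (if ‖z‖ / 2 ≤ ‖y‖ ∧ ‖y‖ < R then ENNReal.ofReal (1 / ‖y‖ ^ 2) else 0) +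
        ENNReal.ofReal (1 / (8 * π ^ 2)) *
          (if ‖z‖ / 2 ≤ ‖y - z‖ ∧ ‖y - z‖ < R then ENNReal.ofReal (1 / ‖y - z‖ ^ 2) else 0)) := by
  have htri : ‖z‖ ≤ ‖y‖ + ‖y - z‖ := by
    have := norm_sub_le y (y - z)
    rwa [sub_sub_cancel] at this
  have hzpos : 0 < ‖z‖ := norm_pos_iff.2 hz
  have ha0 := norm_nonneg y
  have hb0 := norm_nonneg (y - z)
  have hpi := Real.pi_pos
  simp only [trKernel]
  generalize ‖y‖ = a at *
  generalize ‖y - z‖ = b at *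
  generalize ‖z‖ = c at *
  by_cases haR : a < R
  swap
  · simp [haR]
  by_cases hbR : b < R
  swap
  · simp [hbR]
  simp only [haR, hbR, if_true, and_true]
  rw [← ENNReal.ofReal_mul (by positivity)]
  by_cases had : a < c / 2
  · refine le_trans ?_ (le_add_right le_self_add)
    simp only [had, if_true]
    rw [← ENNReal.ofReal_mul (by positivity)]
    refine ENNReal.ofReal_le_ofReal ?_
    have h1 : 1 / b ≤ 1 / (c / 2) := one_div_le_one_div_of_le (by linarith) (by linarith)
    calc 1 / (2 * π * a) * (1 / (2 * π * b)) = (1 / (4 * π ^ 2) * (1 / a)) * (1 / b) := by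
          field_simp; norm_num
      _ ≤ (1 / (4 * π ^ 2) * (1 / a)) * (1 / (c / 2)) := by gcongr
      _ = _ := by field_simp
  by_cases hbd : b < c / 2
  · refine le_trans ?_ (le_add_right le_add_self)
    simp only [hbd, if_true]
    rw [← ENNReal.ofReal_mul (by positivity)]
    refine ENNReal.ofReal_le_ofReal ?_
    have h1 : 1 / a ≤ 1 / (c / 2) := one_div_le_one_div_of_le (by linarith) (by linarith)
    calc 1 / (2 * π * a) * (1 / (2 * π * b)) = (1 / (4 * π ^ 2) * (1 / b)) * (1 / a) := by
          field_simp; norm_num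
      _ ≤ (1 / (4 * π ^ 2) * (1 / b)) * (1 / (c / 2)) := by gcongr
      _ = _ := by field_simp
  · refine le_trans ?_ le_add_self
    simp only [not_lt.1 had, not_lt.1 hbd, if_true]
    rw [← mul_add, ← ENNReal.ofReal_add (by positivity) (by positivity),
      ← ENNReal.ofReal_mul (by positivity)]
    refine ENNReal.ofReal_le_ofReal ?_
    have ha : a ≠ 0 := by intro h; rw [h] at had; exact had (by positivity)
    have hb : b ≠ 0 := by intro h; rw [h] at hbd; exact hbd (by positivity)
    have h2 : 1 / (8 * π ^ 2) * (1 / a ^ 2 + 1 / b ^ 2) - 1 / (2 * π * a) * (1 / (2 * π * b)) =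
        1 / (8 * π ^ 2) * (1 / a - 1 / b) ^ 2 := by
      field_simp; ring
    have h3 : 0 ≤ 1 / (8 * π ^ 2) * (1 / a - 1 / b) ^ 2 := by positivity
    linarith

theorem lintegral_trKernel_mul_trKernel_le {R : ℝ} {z : Plane} (hz : z ≠ 0) :
    ∫⁻ y, trKernel R y * trKernel R (y - z) ≤
      ENNReal.ofReal (1 / (2 * π) * Real.log (2 * R / ‖z‖)) + ENNReal.ofReal (1 / π) := by
  have hzpos : 0 < ‖z‖ := norm_pos_iff.2 hz
  have hd : 0 < ‖z‖ / 2 := by positivity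
  refine (lintegral_mono fun y => trKernel_mul_trKernel_le hz y).trans ?_
  have hA : Measurable fun y : Plane =>
      if ‖y‖ < ‖z‖ / 2 then ENNReal.ofReal (1 / ‖y‖) else 0 :=
    Measurable.ite (measurableSet_lt measurable_norm measurable_const) (by fun_prop)
      measurable_const
  have hB : Measurable fun y : Plane =>
      if ‖z‖ / 2 ≤ ‖y‖ ∧ ‖y‖ < R then ENNReal.ofReal (1 / ‖y‖ ^ 2) else 0 :=
    Measurable.ite ((measurableSet_le measurable_const measurable_norm).inter
      (measurableSet_lt measurable_norm measurable_const)) (by fun_prop) measurable_const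
  have hs : Measurable fun y : Plane => y - z := measurable_id.sub_const z
  have hA' := hA.comp hs
  have hB' := hB.comp hs
  simp only [Function.comp_def] at hA' hB'
  have hadd : Measurable fun y : Plane =>
      ENNReal.ofReal (1 / (8 * π ^ 2)) *
          (if ‖z‖ / 2 ≤ ‖y‖ ∧ ‖y‖ < R then ENNReal.ofReal (1 / ‖y‖ ^ 2) else 0) +
        ENNReal.ofReal (1 / (8 * π ^ 2)) *
          (if ‖z‖ / 2 ≤ ‖y - z‖ ∧ ‖y - z‖ < R then ENNReal.ofReal (1 / ‖y - z‖ ^ 2) else 0) :=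
    (hB.const_mul _).add (hB'.const_mul _)
  rw [lintegral_add_right _ hadd, lintegral_add_right _ (hA'.const_mul _),
    lintegral_add_right _ (hB'.const_mul _)]
  simp only [lintegral_const_mul' _ _ ENNReal.ofReal_ne_top]
  rw [lintegral_sub_right_eq_self (fun y : Plane =>
      if ‖y‖ < ‖z‖ / 2 then ENNReal.ofReal (1 / ‖y‖) else 0) z,
    lintegral_sub_right_eq_self (fun y : Plane =>
      if ‖z‖ / 2 ≤ ‖y‖ ∧ ‖y‖ < R then ENNReal.ofReal (1 / ‖y‖ ^ 2) else 0) z,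
    lintegral_ball_inv_norm, ← ENNReal.ofReal_mul (by positivity),
    ← ENNReal.ofReal_add (by positivity) (by positivity), add_comm, ← two_mul]
  refine add_le_add ?_ (ENNReal.ofReal_le_ofReal (le_of_eq ?_))
  · calc _ ≤ 2 * (ENNReal.ofReal (1 / (8 * π ^ 2)) *
          ENNReal.ofReal (2 * π * Real.log (R / (‖z‖ / 2)))) := by
          gcongr
          exact lintegral_annulus_inv_norm_sq hd
      _ = _ := by
          have h2 : ∀ X : ℝ, 2 * ENNReal.ofReal X = ENNReal.ofReal (2 * X) := fun X => by
            rw [ENNReal.ofReal_mul zero_le_two, ENNReal.ofReal_ofNat]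
          rw [← ENNReal.ofReal_mul (by positivity), h2]
          congr 1
          have : R / (‖z‖ / 2) = 2 * R / ‖z‖ := by field_simp
          rw [this]
          field_simp
          norm_num
  · field_simp
    norm_num

theorem setLIntegral_trKernel_mul_trKernel_le {R : ℝ} (hR : 0 < R) {t : ℝ} {E : Set Plane}
    (hE : ENNReal.ofReal (π * R ^ 2 * Real.exp (-t)) ≤ volume E) (ht : 0 ≤ t) (x' : Plane) :
    ∫⁻ x in E, ∫⁻ y, trKernel R (y - x) * trKernel R (y - x') ≤
      ENNReal.ofReal ((t + 10) / (4 * π)) * volume E := by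
  set ρ := R * Real.exp (-t / 2) with hρ
  have hρ0 : 0 < ρ := by positivity
  have hρ2 : ρ ^ 2 = R ^ 2 * Real.exp (-t) := by
    rw [hρ, mul_pow, ← Real.exp_nat_mul]
    congr 2
    push_cast; ring
  have hlog : Real.log (2 * R / ρ) = Real.log 2 + t / 2 := by
    have : 2 * R / ρ = 2 * Real.exp (t / 2) := by
      rw [hρ, neg_div, Real.exp_neg]; field_simp
    rw [this, Real.log_mul two_ne_zero (Real.exp_pos _).ne', Real.log_exp]
  have hpt : ∀ x, x ≠ x' → ∫⁻ y, trKernel R (y - x) * trKernel R (y - x') ≤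
      ENNReal.ofReal ((t + 6) / (4 * π)) + ENNReal.ofReal (ρ / (2 * π)) *
        (if ‖x - x'‖ < ρ then ENNReal.ofReal (1 / ‖x - x'‖) else 0) := by
    intro x hx
    have hz : x' - x ≠ 0 := sub_ne_zero.2 hx.symm
    have h1 : ∫⁻ y, trKernel R (y - x) * trKernel R (y - x') =
        ∫⁻ y, trKernel R y * trKernel R (y - (x' - x)) := by
      rw [← lintegral_sub_right_eq_self (fun y => trKernel R y * trKernel R (y - (x' - x))) x]
      simp
    rw [h1]
    refine (lintegral_trKernel_mul_trKernel_le hz).trans ?_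
    rw [norm_sub_rev x' x]
    have hn : 0 < ‖x - x'‖ := norm_pos_iff.2 (sub_ne_zero.2 hx)
    generalize ‖x - x'‖ = c at *
    have h2 : Real.log (2 * R / c) = Real.log (2 * R / ρ) + Real.log (ρ / c) := by
      rw [← Real.log_mul (by positivity) (by positivity)]
      congr 1
      field_simp
    have hl2 : Real.log 2 ≤ 1 := by linarith [Real.log_two_lt_d9]
    rw [h2, hlog]
    have h3 : ENNReal.ofReal (1 / (2 * π) * (Real.log 2 + t / 2 + Real.log (ρ / c))) ≤
        ENNReal.ofReal ((t + 2) / (4 * π)) + ENNReal.ofReal (ρ / (2 * π)) *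
        (if c < ρ then ENNReal.ofReal (1 / c) else 0) := by
      have h5 : 1 / (2 * π) * (Real.log 2 + t / 2) ≤ (t + 2) / (4 * π) := by
        calc _ ≤ 1 / (2 * π) * (1 + t / 2) := by gcongr
          _ = _ := by field_simp; ring
      rw [mul_add]
      by_cases hc : c < ρ
      · simp only [hc, if_true]
        rw [← ENNReal.ofReal_mul (by positivity)]
        refine ENNReal.ofReal_add_le.trans (add_le_add (ENNReal.ofReal_le_ofReal h5)
          (ENNReal.ofReal_le_ofReal ?_))
        calc 1 / (2 * π) * Real.log (ρ / c) ≤ 1 / (2 * π) * (ρ / c) := by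
              gcongr
              exact (Real.log_le_sub_one_of_pos (by positivity)).trans (by linarith)
          _ = _ := by field_simp
      · simp only [hc, if_false, mul_zero, add_zero]
        refine ENNReal.ofReal_le_ofReal ?_
        have h4 : Real.log (ρ / c) ≤ 0 :=
          Real.log_nonpos (by positivity) ((div_le_one hn).2 (not_lt.1 hc))
        have h6 : 1 / (2 * π) * Real.log (ρ / c) ≤ 0 :=
          mul_nonpos_of_nonneg_of_nonpos (by positivity) h4
        linarith
    calc _ ≤ _ := add_le_add_left h3 _
      _ = _ := by
          rw [add_right_comm, ← ENNReal.ofReal_add (by positivity) (by positivity)]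
          congr 2
          field_simp
          norm_num [add_assoc]
  have hA : Measurable fun x : Plane => if ‖x‖ < ρ then ENNReal.ofReal (1 / ‖x‖) else 0 :=
    Measurable.ite (measurableSet_lt measurable_norm measurable_const) (by fun_prop)
      measurable_const
  have hae : ∀ᵐ x ∂(volume.restrict E), x ≠ x' := by
    refine ae_restrict_of_ae ?_
    simp [ae_iff]
  calc _ ≤ ∫⁻ x in E, (ENNReal.ofReal ((t + 6) / (4 * π)) + ENNReal.ofReal (ρ / (2 * π)) *
        (if ‖x - x'‖ < ρ then ENNReal.ofReal (1 / ‖x - x'‖) else 0)) :=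
        lintegral_mono_ae (hae.mono hpt)
    _ ≤ ENNReal.ofReal ((t + 6) / (4 * π)) * volume E + ENNReal.ofReal (ρ / (2 * π)) *
        ∫⁻ x : Plane, (if ‖x - x'‖ < ρ then ENNReal.ofReal (1 / ‖x - x'‖) else 0) := by
        rw [lintegral_add_left measurable_const, setLIntegral_const,
          lintegral_const_mul' _ _ ENNReal.ofReal_ne_top]
        refine add_le_add le_rfl (mul_le_mul' le_rfl (setLIntegral_le_lintegral _ _))
    _ ≤ ENNReal.ofReal ((t + 6) / (4 * π)) * volume E + ENNReal.ofReal (1 / π) * volume E := by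
        rw [lintegral_sub_right_eq_self (fun x : Plane =>
          if ‖x‖ < ρ then ENNReal.ofReal (1 / ‖x‖) else 0) x', lintegral_ball_inv_norm,
          ← ENNReal.ofReal_mul (by positivity)]
        gcongr
        refine le_trans (le_of_eq ?_) (mul_le_mul_right hE _)
        rw [← ENNReal.ofReal_mul (by positivity), mul_assoc π, ← hρ2]
        congr 1
        field_simp
    _ = _ := by
        rw [← add_mul, ← ENNReal.ofReal_add (by positivity) (by positivity)]
        congr 2
        field_simp
        ring

/-- The truncated Riesz potential of the indicator function of `E`. -/
def setPotential (R : ℝ) (E : Set Plane) (y : Plane) : ℝ≥0∞ := ∫⁻ x in E, trKernel R (y - x)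

theorem measurable_setPotential (R : ℝ) (E : Set Plane) : Measurable (setPotential R E) := by
  refine Measurable.lintegral_prod_right' (f := fun p : Plane × Plane => trKernel R (p.1 - p.2)) ?_
  exact (measurable_trKernel R).comp (measurable_fst.sub measurable_snd)

theorem lintegral_setPotential_mul_setPotential_le {R : ℝ} (hR : 0 < R) {t : ℝ} (ht : 0 ≤ t)
    {E E' : Set Plane} (hE : ENNReal.ofReal (π * R ^ 2 * Real.exp (-t)) ≤ volume E) :
    ∫⁻ y, setPotential R E y * setPotential R E' y ≤
      ENNReal.ofReal ((t + 10) / (4 * π)) * volume E * volume E' := by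
  have hk := measurable_trKernel R
  have h1 : ∀ y, setPotential R E y * setPotential R E' y =
      ∫⁻ x' in E', ∫⁻ x in E, trKernel R (y - x) * trKernel R (y - x') := by
    intro y
    have hm : ∀ y : Plane, Measurable fun x => trKernel R (y - x) :=
      fun y => hk.comp (measurable_const.sub measurable_id)
    simp_rw [lintegral_mul_const _ (hm y), lintegral_const_mul _ (hm y)]
    rfl
  have hm3 : Measurable fun p : (Plane × Plane) × Plane =>
      trKernel R (p.1.1 - p.2) * trKernel R (p.1.1 - p.1.2) :=
    (hk.comp (by fun_prop)).mul (hk.comp (by fun_prop))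
  simp_rw [h1]
  rw [lintegral_lintegral_swap]
  swap
  · exact (hm3.lintegral_prod_right').aemeasurable
  calc _ ≤ ∫⁻ _ in E', ENNReal.ofReal ((t + 10) / (4 * π)) * volume E := by
        refine lintegral_mono fun x' => ?_
        dsimp only
        rw [lintegral_lintegral_swap]
        · exact setLIntegral_trKernel_mul_trKernel_le hR hE ht x'
        · exact Measurable.aemeasurable
            ((hk.comp (measurable_fst.sub measurable_snd)).mul
              (hk.comp (measurable_fst.sub_const x')))
    _ = _ := by rw [setLIntegral_const]
theorem sq_lintegral_mul_le {α : Type*} [MeasurableSpace α] {ν : Measure α} {φ g : α → ℝ≥0∞}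
    (hφ : AEMeasurable φ ν) (hg : AEMeasurable g ν) :
    (∫⁻ a, φ a * g a ∂ν) ^ 2 ≤ (∫⁻ a, φ a ^ 2 ∂ν) * ∫⁻ a, g a ^ 2 ∂ν := by
  have h := ENNReal.lintegral_mul_le_Lp_mul_Lq ν Real.HolderConjugate.two_two hφ hg
  simp only [Pi.mul_apply, ENNReal.rpow_two] at h
  calc _ ≤ _ := pow_le_pow_left' h 2
    _ = _ := by
      rw [mul_pow, ← ENNReal.rpow_two, ← ENNReal.rpow_two, ← ENNReal.rpow_mul, ← ENNReal.rpow_mul]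
      norm_num

theorem ofReal_mul_measure_superlevel_le {κ : ℝ} (hκ : 0 < κ) {u : Plane → ℝ}
    (hu : Differentiable ℝ u) (s : ℝ) :
    ENNReal.ofReal s * volume {x | s < |u x|} ≤
      ∫⁻ y, energyDensity κ u y * setPotential (π / (2 * κ)) {x | s < |u x|} y := by
  have hk := measurable_trKernel (π / (2 * κ))
  have hme := measurable_energyDensity κ hu
  have hms : MeasurableSet {x | s < |u x|} :=
    (isOpen_lt continuous_const hu.continuous.abs).measurableSet
  calc _ = ∫⁻ _ in {x | s < |u x|}, ENNReal.ofReal s := by rw [setLIntegral_const]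
    _ ≤ ∫⁻ x in {x | s < |u x|}, ENNReal.ofReal |u x| :=
      setLIntegral_mono' hms fun x hx => ENNReal.ofReal_le_ofReal (Set.mem_ofPred.1 hx).le
    _ ≤ ∫⁻ x in {x | s < |u x|}, ∫⁻ y, trKernel (π / (2 * κ)) (y - x) * energyDensity κ u y :=
      lintegral_mono fun x => ofReal_abs_le_lintegral_trKernel hκ hu x
    _ = ∫⁻ y, ∫⁻ x in {x | s < |u x|}, trKernel (π / (2 * κ)) (y - x) * energyDensity κ u y := by
      rw [lintegral_lintegral_swap]
      exact Measurable.aemeasurable ((hk.comp (measurable_snd.sub measurable_fst)).mul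
        (hme.comp measurable_snd))
    _ = _ := by
      refine lintegral_congr fun y => ?_
      have hm : Measurable fun x => trKernel (π / (2 * κ)) (y - x) :=
        hk.comp (measurable_const.sub measurable_id)
      rw [lintegral_mul_const _ hm, mul_comm]
      rfl

theorem sq_add_le_of_measure_superlevel {κ : ℝ} (hκ : 0 < κ) {u : Plane → ℝ}
    (hu : Differentiable ℝ u) (hE : ∫⁻ y, energyDensity κ u y ^ 2 ≤ 1) {s s' t t' : ℝ}
    (hs : 0 ≤ s) (hs' : 0 ≤ s') (ht : 0 ≤ t) (ht' : 0 ≤ t')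
    (hfin : volume {x | s < |u x|} ≠ ∞) (hfin' : volume {x | s' < |u x|} ≠ ∞)
    (hm : ENNReal.ofReal (π * (π / (2 * κ)) ^ 2 * Real.exp (-t)) ≤ volume {x | s < |u x|})
    (hm' : ENNReal.ofReal (π * (π / (2 * κ)) ^ 2 * Real.exp (-t')) ≤ volume {x | s' < |u x|}) :
    4 * π * (s + s') ^ 2 ≤ 3 * t + t' + 40 := by
  have hR : 0 < π / (2 * κ) := by positivity
  have h1 := ofReal_mul_measure_superlevel_le hκ hu s
  have h1' := ofReal_mul_measure_superlevel_le hκ hu s'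
  set R := π / (2 * κ) with hRdef
  set E := {x | s < |u x|}
  set E' := {x | s' < |u x|}
  have hpos : volume E ≠ 0 := fun h => by
    rw [h, nonpos_iff_eq_zero, ENNReal.ofReal_eq_zero] at hm
    exact absurd hm (not_le.2 (by positivity))
  have hpos' : volume E' ≠ 0 := fun h => by
    rw [h, nonpos_iff_eq_zero, ENNReal.ofReal_eq_zero] at hm'
    exact absurd hm' (not_le.2 (by positivity))
  have hg1 := lintegral_setPotential_mul_setPotential_le hR ht (E' := E) hm
  have hg2 := lintegral_setPotential_mul_setPotential_le hR ht (E' := E') hm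
  have hg3 := lintegral_setPotential_mul_setPotential_le hR ht' (E' := E') hm'
  have hme := measurable_energyDensity κ hu
  have hP := measurable_setPotential R E
  have hP' := measurable_setPotential R E'
  have ha : (volume E)⁻¹ * volume E = 1 := ENNReal.inv_mul_cancel hpos hfin
  have ha' : (volume E')⁻¹ * volume E' = 1 := ENNReal.inv_mul_cancel hpos' hfin'
  generalize volume E = a at *
  generalize volume E' = a' at *
  generalize setPotential R E = P at *
  generalize setPotential R E' = P' at *
  have hmg : Measurable fun y => a⁻¹ * P y + a'⁻¹ * P' y := (hP.const_mul _).add (hP'.const_mul _)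
  have hφP : Measurable fun y => energyDensity κ u y * P y := hme.mul hP
  have hφP' : Measurable fun y => energyDensity κ u y * P' y := hme.mul hP'
  have hPP : Measurable fun y => P y * P y := hP.mul hP
  have hPP' : Measurable fun y => P y * P' y := hP.mul hP'
  have hP'P' : Measurable fun y => P' y * P' y := hP'.mul hP'
  have hlin : ENNReal.ofReal (s + s') ≤
      ∫⁻ y, energyDensity κ u y * (a⁻¹ * P y + a'⁻¹ * P' y) := by
    have e1 : ∀ y, energyDensity κ u y * (a⁻¹ * P y + a'⁻¹ * P' y) =
        a⁻¹ * (energyDensity κ u y * P y) + a'⁻¹ * (energyDensity κ u y * P' y) :=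
      fun y => by ring
    simp_rw [e1]
    rw [lintegral_add_left (hφP.const_mul _), lintegral_const_mul _ hφP,
      lintegral_const_mul _ hφP', ENNReal.ofReal_add hs hs']
    refine add_le_add ?_ ?_
    · calc ENNReal.ofReal s = a⁻¹ * (ENNReal.ofReal s * a) := by
            rw [mul_left_comm, ha, mul_one]
        _ ≤ _ := by gcongr
    · calc ENNReal.ofReal s' = a'⁻¹ * (ENNReal.ofReal s' * a') := by
            rw [mul_left_comm, ha', mul_one]
        _ ≤ _ := by gcongr
  have hsq : ∫⁻ y, (a⁻¹ * P y + a'⁻¹ * P' y) ^ 2 ≤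
      ENNReal.ofReal ((3 * t + t' + 40) / (4 * π)) := by
    have e1 : ∀ y, (a⁻¹ * P y + a'⁻¹ * P' y) ^ 2 = a⁻¹ * a⁻¹ * (P y * P y) +
        (2 * a⁻¹ * a'⁻¹ * (P y * P' y) + a'⁻¹ * a'⁻¹ * (P' y * P' y)) :=
      fun y => by ring
    simp_rw [e1]
    rw [lintegral_add_left (hPP.const_mul _),
      lintegral_add_left (hPP'.const_mul _), lintegral_const_mul _ hPP,
      lintegral_const_mul _ hPP', lintegral_const_mul _ hP'P']
    calc _ ≤ a⁻¹ * a⁻¹ * (ENNReal.ofReal ((t + 10) / (4 * π)) * a * a) +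
        (2 * a⁻¹ * a'⁻¹ * (ENNReal.ofReal ((t + 10) / (4 * π)) * a * a') +
          a'⁻¹ * a'⁻¹ * (ENNReal.ofReal ((t' + 10) / (4 * π)) * a' * a')) := by gcongr
      _ = (a⁻¹ * a) * (a⁻¹ * a) * ENNReal.ofReal ((t + 10) / (4 * π)) +
        (2 * (a⁻¹ * a) * (a'⁻¹ * a') * ENNReal.ofReal ((t + 10) / (4 * π)) +
          (a'⁻¹ * a') * (a'⁻¹ * a') * ENNReal.ofReal ((t' + 10) / (4 * π))) := by ring
      _ = _ := by
        rw [ha, ha', one_mul, one_mul, one_mul, mul_one, mul_one, two_mul,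
          ← ENNReal.ofReal_add (by positivity) (by positivity),
          ← ENNReal.ofReal_add (by positivity) (by positivity),
          ← ENNReal.ofReal_add (by positivity) (by positivity)]
        congr 1
        field_simp
        ring
  have hfinal : ENNReal.ofReal ((s + s') ^ 2) ≤ ENNReal.ofReal ((3 * t + t' + 40) / (4 * π)) := by
    rw [ENNReal.ofReal_pow (by positivity)]
    calc _ ≤ _ := pow_le_pow_left' hlin 2
      _ ≤ _ := sq_lintegral_mul_le hme.aemeasurable hmg.aemeasurable
      _ ≤ 1 * _ := mul_le_mul' hE hsq
      _ = _ := one_mul _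
  rw [ENNReal.ofReal_le_ofReal_iff (by positivity), le_div_iff₀ (by positivity)] at hfinal
  linarith
theorem sub_le_of_pair_bound {a b p q l : ℝ} (ha : 0 ≤ a) (hb : 0 ≤ b) (hl : 0 ≤ l) (hp : 0 < p)
    (hpl : l ≤ p) (hpa : p ≤ a ^ 2) (hqb : q ≤ b ^ 2) (hpq : p ≤ q)
    (h : (a + b) ^ 2 ≤ 3 * p + q + 4 * l) : q - p ≤ 8 * l := by
  have h1 : √p ≤ a := (Real.sqrt_le_left ha).2 hpa
  have h2 : √q ≤ b := (Real.sqrt_le_left hb).2 hqb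
  have h3 : (√p + √q) ^ 2 ≤ (a + b) ^ 2 := by gcongr
  have hq : 0 ≤ q := hp.le.trans hpq
  have e1 := Real.sq_sqrt hp.le
  have e2 := Real.sq_sqrt hq
  have h4 : √p * √q ≤ p + 2 * l := by nlinarith
  have h5 : (√p * √q) ^ 2 ≤ (p + 2 * l) ^ 2 := by gcongr
  rw [mul_pow, e1, e2] at h5
  have h6 : p * q ≤ p * (p + 8 * l) := by nlinarith
  linarith [le_of_mul_le_mul_left h6 hp]

/-- Counting form of the Adams–Garsia argument. -/
theorem tsum_indicator_le_of_pair_bound {b : ℕ → ℝ} (hb : ∀ n, 0 ≤ b n)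
    (hpair : ∀ n m, n ≤ m → 0 < b n → 0 < b m → (b n + b m) ^ 2 ≤ 3 * n + m + 40) (j : ℕ) :
    ∑' n : ℕ, (if (n : ℝ) - j ≤ b n ^ 2 then 1 else 0 : ℝ≥0∞) ≤ 91 * (j + 1) := by
  obtain ⟨n₁, hn₁⟩ : ∃ n₁ : ℕ, ∀ n : ℕ, (n : ℝ) - j ≤ b n ^ 2 →
      n < 2 * j + 10 ∨ (n₁ ≤ n ∧ n ≤ n₁ + (8 * j + 80)) := by
    by_cases hex : ∃ n : ℕ, (n : ℝ) - j ≤ b n ^ 2 ∧ 2 * j + 10 ≤ n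
    swap
    · refine ⟨0, fun n hn => Or.inl ?_⟩
      by_contra hlt
      exact hex ⟨n, hn, not_lt.1 hlt⟩
    refine ⟨Nat.find hex, fun m hm => ?_⟩
    by_cases hmj : m < 2 * j + 10
    · exact Or.inl hmj
    right
    have hle : Nat.find hex ≤ m := Nat.find_min' hex ⟨hm, not_lt.1 hmj⟩
    refine ⟨hle, ?_⟩
    obtain ⟨hn, hnj⟩ := Nat.find_spec hex
    generalize Nat.find hex = n at *
    have hnj' : 2 * (j : ℝ) + 10 ≤ n := by exact_mod_cast hnj
    have hle' : (n : ℝ) ≤ m := by exact_mod_cast hle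
    have hj0 : (0 : ℝ) ≤ j := j.cast_nonneg
    have hpos : ∀ k : ℕ, (n : ℝ) ≤ k → (k : ℝ) - j ≤ b k ^ 2 → 0 < b k := by
      intro k hk hkb
      refine (hb k).lt_of_ne fun h => ?_
      rw [← h] at hkb
      linarith
    have := sub_le_of_pair_bound (l := j + 10) (hb n) (hb m) (by linarith) (by linarith)
      (by linarith) hn hm (by linarith)
      (by linarith [hpair n m hle (hpos n le_rfl hn) (hpos m hle' hm)])
    have h8 : (m : ℝ) ≤ n + (8 * j + 80) := by linarith
    exact_mod_cast h8
  calc _ ≤ ∑' n : ℕ, (if n ∈ Finset.range (2 * j + 10) ∪ Finset.Icc n₁ (n₁ + (8 * j + 80))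
        then 1 else 0 : ℝ≥0∞) := by
        refine ENNReal.tsum_le_tsum fun n => ?_
        by_cases h : (n : ℝ) - j ≤ b n ^ 2
        · have : n ∈ Finset.range (2 * j + 10) ∪ Finset.Icc n₁ (n₁ + (8 * j + 80)) := by
            simpa using hn₁ n h
          simp only [h, this, if_true, le_refl]
        · simp [h]
    _ = ((Finset.range (2 * j + 10) ∪ Finset.Icc n₁ (n₁ + (8 * j + 80))).card : ℝ≥0∞) := by
        rw [tsum_eq_sum (s := Finset.range (2 * j + 10) ∪ Finset.Icc n₁ (n₁ + (8 * j + 80)))]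
        · rw [Finset.sum_ite_mem, Finset.inter_self]
          simp
        · intro n hn
          simp only [hn, if_false]
    _ ≤ ((91 * (j + 1) : ℕ) : ℝ≥0∞) := by
        refine Nat.cast_le.2 ((Finset.card_union_le _ _).trans ?_)
        rw [Finset.card_range, Nat.card_Icc]
        omega
    _ = _ := by push_cast; ring

theorem exists_tsum_exp_le :
    ∃ C : ℝ, 0 < C ∧ ∀ b : ℕ → ℝ, (∀ n, 0 ≤ b n) → (∀ n, b n ^ 2 ≤ n + 10) →
      (∀ n m, n ≤ m → 0 < b n → 0 < b m → (b n + b m) ^ 2 ≤ 3 * n + m + 40) →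
      ∑' n : ℕ, ENNReal.ofReal (Real.exp (b n ^ 2 - n)) ≤ ENNReal.ofReal C := by
  have hs : Summable fun j : ℕ => Real.exp 10 * Real.exp (-j) * (91 * ((j : ℝ) + 1)) := by
    have h1 := Real.summable_pow_mul_exp_neg_nat_mul 1 one_pos
    have h0 := Real.summable_pow_mul_exp_neg_nat_mul 0 one_pos
    refine ((h1.add h0).mul_left (91 * Real.exp 10)).congr fun j => ?_
    simp only [pow_one, pow_zero, neg_mul, one_mul]
    ring
  refine ⟨∑' j : ℕ, Real.exp 10 * Real.exp (-j) * (91 * ((j : ℝ) + 1)),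
    hs.tsum_pos (fun j => by positivity) 0 (by positivity), fun b hb hsingle hpair => ?_⟩
  have hpt : ∀ n : ℕ, ENNReal.ofReal (Real.exp (b n ^ 2 - n)) ≤
      ∑' j : ℕ, ENNReal.ofReal (Real.exp 10 * Real.exp (-j)) *
        (if (n : ℝ) - j ≤ b n ^ 2 then 1 else 0) := by
    intro n
    set δ : ℝ := n - b n ^ 2 + 10 with hδ
    have hδ0 : 0 ≤ δ := by linarith [hsingle n]
    have h1 := Nat.floor_le hδ0
    have h2 := Nat.lt_floor_add_one δ
    refine le_trans ?_ (ENNReal.le_tsum ⌊δ⌋₊)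
    rw [if_pos (by linarith), mul_one, ← Real.exp_add]
    refine ENNReal.ofReal_le_ofReal (Real.exp_le_exp.2 (by linarith))
  calc _ ≤ _ := ENNReal.tsum_le_tsum hpt
    _ = ∑' j : ℕ, ENNReal.ofReal (Real.exp 10 * Real.exp (-j)) *
        ∑' n : ℕ, (if (n : ℝ) - j ≤ b n ^ 2 then 1 else 0) := by
        rw [ENNReal.tsum_comm]
        simp_rw [ENNReal.tsum_mul_left]
    _ ≤ ∑' j : ℕ, ENNReal.ofReal (Real.exp 10 * Real.exp (-j) * (91 * ((j : ℝ) + 1))) := by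
        refine ENNReal.tsum_le_tsum fun j => ?_
        rw [ENNReal.ofReal_mul (p := Real.exp 10 * Real.exp (-j)) (by positivity)]
        refine mul_le_mul' le_rfl ?_
        refine (tsum_indicator_le_of_pair_bound hb hpair j).trans (le_of_eq ?_)
        rw [ENNReal.ofReal_mul (by positivity), ENNReal.ofReal_add (by positivity) zero_le_one]
        simp
    _ = _ := (ENNReal.ofReal_tsum_of_nonneg (fun j => by positivity) hs).symm
theorem F_le_exp (s : ℝ) : F s ≤ Real.exp (4 * π * s ^ 2) / (8 * π) := by
  have hpi := Real.pi_pos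
  rw [F, inv_mul_eq_div]
  gcongr
  have h1 : 0 ≤ 4 * π * s ^ 2 := by positivity
  have h2 : 0 ≤ 8 * π ^ 2 * s ^ 4 := by positivity
  linarith

theorem F_le_sq {s B : ℝ} (hs : 4 * π * s ^ 2 ≤ B) : F s ≤ Real.exp B / 2 * s ^ 2 := by
  have hpi := Real.pi_pos
  have h0 : 0 ≤ 4 * π * s ^ 2 := by positivity
  have h1 : Real.exp (4 * π * s ^ 2) - 1 ≤ 4 * π * s ^ 2 * Real.exp B := by
    have h2 : 1 - 4 * π * s ^ 2 ≤ Real.exp (-(4 * π * s ^ 2)) := by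
      linarith [Real.add_one_le_exp (-(4 * π * s ^ 2))]
    have h3 := mul_le_mul_of_nonneg_right h2 (Real.exp_pos (4 * π * s ^ 2)).le
    rw [← Real.exp_add, neg_add_cancel, Real.exp_zero] at h3
    have h4 := mul_le_mul_of_nonneg_left (Real.exp_le_exp.2 hs) h0
    linarith
  have h5 : 0 ≤ 8 * π ^ 2 * s ^ 4 := by positivity
  calc F s ≤ (8 * π)⁻¹ * (4 * π * s ^ 2 * Real.exp B) := by
        rw [F]
        gcongr
        linarith
    _ = _ := by field_simp; ring

/-- The smallest level whose superlevel set has measure at most `a`. -/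
def rearrLevel (u : Plane → ℝ) (a : ℝ) : ℝ :=
  sInf {s : ℝ | 0 ≤ s ∧ volume {x | s < |u x|} ≤ ENNReal.ofReal a}

theorem rearrLevel_nonneg (u : Plane → ℝ) (a : ℝ) : 0 ≤ rearrLevel u a :=
  Real.sInf_nonneg fun _ hs => hs.1

theorem lt_measure_superlevel {u : Plane → ℝ} {a s : ℝ} (hs : 0 ≤ s) (h : s < rearrLevel u a) :
    ENNReal.ofReal a < volume {x | s < |u x|} := by
  by_contra hcon
  have hbdd : BddBelow {s : ℝ | 0 ≤ s ∧ volume {x | s < |u x|} ≤ ENNReal.ofReal a} :=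
    ⟨0, fun _ ht => ht.1⟩
  have hle : rearrLevel u a ≤ s := csInf_le hbdd ⟨hs, not_lt.1 hcon⟩
  exact absurd hle (not_le.2 h)

theorem measure_superlevel_rearrLevel_le {u : Plane → ℝ} {a : ℝ}
    (hne : {s : ℝ | 0 ≤ s ∧ volume {x | s < |u x|} ≤ ENNReal.ofReal a}.Nonempty) :
    volume {x | rearrLevel u a < |u x|} ≤ ENNReal.ofReal a := by
  have hU : {x | rearrLevel u a < |u x|} =
      ⋃ k : ℕ, {x | rearrLevel u a + 1 / ((k : ℝ) + 1) < |u x|} := by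
    ext x
    simp only [Set.mem_ofPred_eq, Set.mem_iUnion]
    constructor
    · intro hx
      obtain ⟨k, hk⟩ := exists_nat_one_div_lt (sub_pos.2 hx)
      exact ⟨k, by linarith⟩
    · rintro ⟨k, hk⟩
      have : (0 : ℝ) < 1 / ((k : ℝ) + 1) := by positivity
      linarith
  have hmono : Monotone fun k : ℕ => {x | rearrLevel u a + 1 / ((k : ℝ) + 1) < |u x|} := by
    intro k l hkl x hx
    have : 1 / ((l : ℝ) + 1) ≤ 1 / ((k : ℝ) + 1) := by gcongr
    simp only [Set.mem_ofPred_eq] at hx ⊢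
    linarith
  rw [hU, hmono.measure_iUnion]
  refine iSup_le fun k => ?_
  have hpos : (0 : ℝ) < 1 / ((k : ℝ) + 1) := by positivity
  obtain ⟨s, hs, hlt⟩ := exists_lt_of_csInf_lt hne
    (show rearrLevel u a < rearrLevel u a + 1 / ((k : ℝ) + 1) by linarith)
  exact (measure_mono fun x hx => hlt.trans hx).trans hs.2

theorem measure_superlevel_ne_top {u : Plane → ℝ} (hu : Integrable fun x => u x ^ 2) {s : ℝ}
    (hs : 0 < s) : volume {x | s < |u x|} ≠ ∞ := by
  refine ((measure_mono fun x hx => ?_).trans_lt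
    (hu.measure_gt_lt_top (pow_pos hs 2))).ne
  simp only [Set.mem_ofPred_eq] at hx ⊢
  rw [← sq_abs (u x)]
  gcongr

theorem lintegral_energyDensity_sq {κ : ℝ} {u : Plane → ℝ} (hu : MemH1 u) :
    ∫⁻ y, energyDensity κ u y ^ 2 =
      ENNReal.ofReal ((∫ x, gradNorm u x ^ 2) + κ ^ 2 * ∫ x, u x ^ 2) := by
  have hint : Integrable fun x => gradNorm u x ^ 2 + κ ^ 2 * u x ^ 2 :=
    hu.2.2.add (hu.2.1.const_mul _)
  rw [← integral_const_mul, ← integral_add hu.2.2 (hu.2.1.const_mul _),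
    ofReal_integral_eq_lintegral_ofReal hint
      (Filter.Eventually.of_forall fun x => by simp only [Pi.zero_apply]; positivity)]
  refine lintegral_congr fun y => ?_
  rw [energyDensity, ← ENNReal.ofReal_pow (Real.sqrt_nonneg _), Real.sq_sqrt (by positivity)]

theorem rearrLevel_pair_bound {κ : ℝ} (hκ : 0 < κ) {u : Plane → ℝ} (hu : MemH1 u)
    (hE : ∫⁻ y, energyDensity κ u y ^ 2 ≤ 1) {t t' : ℝ} (ht : 0 ≤ t) (ht' : 0 ≤ t')
    (hpos : 0 < rearrLevel u (π * (π / (2 * κ)) ^ 2 * Real.exp (-t)))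
    (hpos' : 0 < rearrLevel u (π * (π / (2 * κ)) ^ 2 * Real.exp (-t'))) :
    4 * π * (rearrLevel u (π * (π / (2 * κ)) ^ 2 * Real.exp (-t)) +
      rearrLevel u (π * (π / (2 * κ)) ^ 2 * Real.exp (-t'))) ^ 2 ≤ 3 * t + t' + 40 := by
  set σ := rearrLevel u (π * (π / (2 * κ)) ^ 2 * Real.exp (-t))
  set σ' := rearrLevel u (π * (π / (2 * κ)) ^ 2 * Real.exp (-t'))
  have hlim : Filter.Tendsto (fun c : ℝ => 4 * π * (c * σ + c * σ') ^ 2) (nhdsWithin 1 (Set.Iio 1))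
      (nhds (4 * π * (1 * σ + 1 * σ') ^ 2)) :=
    (Continuous.tendsto (by fun_prop) 1).mono_left nhdsWithin_le_nhds
  rw [one_mul, one_mul] at hlim
  refine le_of_tendsto hlim ?_
  filter_upwards [Ioo_mem_nhdsLT (zero_lt_one' ℝ)] with c hc
  have h1 : 0 < c * σ := mul_pos hc.1 hpos
  have h1' : 0 < c * σ' := mul_pos hc.1 hpos'
  exact sq_add_le_of_measure_superlevel hκ hu.1 hE h1.le h1'.le ht ht'
    (measure_superlevel_ne_top hu.2.1 h1) (measure_superlevel_ne_top hu.2.1 h1')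
    (lt_measure_superlevel h1.le (mul_lt_of_lt_one_left hpos hc.2)).le
    (lt_measure_superlevel h1'.le (mul_lt_of_lt_one_left hpos' hc.2)).le

theorem rearrLevel_set_nonempty {κ : ℝ} (hκ : 0 < κ) {u : Plane → ℝ} (hu : MemH1 u)
    (hE : ∫⁻ y, energyDensity κ u y ^ 2 ≤ 1) {t : ℝ} (ht : 0 ≤ t) :
    {s : ℝ | 0 ≤ s ∧ volume {x | s < |u x|} ≤
      ENNReal.ofReal (π * (π / (2 * κ)) ^ 2 * Real.exp (-t))}.Nonempty := by
  have hs : 0 < √((t + 11) / (4 * π)) := Real.sqrt_pos.2 (by positivity)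
  refine ⟨√((t + 11) / (4 * π)), hs.le, ?_⟩
  by_contra hcon
  have hfin := measure_superlevel_ne_top hu.2.1 hs
  have h := sq_add_le_of_measure_superlevel hκ hu.1 hE hs.le hs.le ht ht hfin hfin
    (not_le.1 hcon).le (not_le.1 hcon).le
  rw [← two_mul, mul_pow, Real.sq_sqrt (by positivity)] at h
  have : 4 * π * (2 ^ 2 * ((t + 11) / (4 * π))) = 4 * (t + 11) := by field_simp; norm_num
  linarith

/-- Layer decomposition of the potential energy along a sequence of levels. -/
theorem lintegral_F_le_of_levels {u : Plane → ℝ} (hu : Measurable u) {σ : ℕ → ℝ} {a : ℕ → ℝ≥0∞}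
    {B : ℝ} (hB : 4 * π * σ 0 ^ 2 ≤ B) (ha : ∀ n, volume {x | σ n < |u x|} ≤ a n)
    (hlim : Filter.Tendsto a Filter.atTop (nhds 0)) :
    ∫⁻ x, ENNReal.ofReal (F (u x)) ≤ (∫⁻ x, ENNReal.ofReal (Real.exp B / 2 * u x ^ 2)) +
      ∑' n, ENNReal.ofReal (Real.exp (4 * π * σ (n + 1) ^ 2) / (8 * π)) * a n := by
  have hae : ∀ᵐ x, ∃ n, |u x| ≤ σ n := by
    rw [ae_iff]
    refine nonpos_iff_eq_zero.1 (ge_of_tendsto' hlim fun n => ?_)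
    refine (measure_mono fun x hx => ?_).trans (ha n)
    exact not_le.1 fun h => hx ⟨n, h⟩
  have hmeas : ∀ n, MeasurableSet {x | σ n < |u x|} := fun n =>
    measurableSet_lt measurable_const hu.abs
  have hpt : ∀ x, (∃ n, |u x| ≤ σ n) → ENNReal.ofReal (F (u x)) ≤
      ENNReal.ofReal (Real.exp B / 2 * u x ^ 2) + ∑' n, {x | σ n < |u x|}.indicator
        (fun _ => ENNReal.ofReal (Real.exp (4 * π * σ (n + 1) ^ 2) / (8 * π))) x := by
    intro x hx
    rcases hn : Nat.find hx with _ | n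
    · refine le_add_right (ENNReal.ofReal_le_ofReal (F_le_sq (le_trans ?_ hB)))
      have h0 := Nat.find_spec hx
      rw [hn] at h0
      rw [← sq_abs (u x)]
      gcongr
    · refine le_add_left (le_trans ?_ (ENNReal.le_tsum n))
      have h1 := Nat.find_spec hx
      rw [hn] at h1
      have h2 : σ n < |u x| := not_le.1 (Nat.find_min hx (by omega))
      rw [Set.indicator_of_mem (by exact h2)]
      refine ENNReal.ofReal_le_ofReal ((F_le_exp _).trans ?_)
      rw [← sq_abs (u x)]
      gcongr
  calc _ ≤ _ := lintegral_mono_ae (hae.mono hpt)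
    _ = (∫⁻ x, ENNReal.ofReal (Real.exp B / 2 * u x ^ 2)) +
        ∑' n, ENNReal.ofReal (Real.exp (4 * π * σ (n + 1) ^ 2) / (8 * π)) *
          volume {x | σ n < |u x|} := by
      rw [lintegral_add_left (by fun_prop), lintegral_tsum fun n =>
        (measurable_const.indicator (hmeas n)).aemeasurable]
      simp_rw [lintegral_indicator_const (hmeas _)]
    _ ≤ _ := by gcongr with n; exact ha n

/-- bound on the potential energy via Trudinger–Moser and scaling. -/
theorem statement6 :
    ∃ M : ℝ, 0 < M ∧ ∀ μ : ℝ, 0 < μ → ∀ u : Plane → ℝ, MemH1 u →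
      (∫ x : Plane, gradNorm u x ^ 2) + μ * (∫ x : Plane, u x ^ 2) ≤ 1 →
      ∫⁻ x : Plane, ENNReal.ofReal (F (u x)) ≤ ENNReal.ofReal (M / μ) := by
  obtain ⟨C, hC, hsum⟩ := exists_tsum_exp_le
  refine ⟨Real.exp 10 / 2 + π ^ 2 * Real.exp 1 / 32 * C, by positivity, ?_⟩
  intro μ hμ u hu hle
  set κ := √μ with hκdef
  have hκ : 0 < κ := Real.sqrt_pos.2 hμ
  have hκ2 : κ ^ 2 = μ := Real.sq_sqrt hμ.le
  have hE : ∫⁻ y, energyDensity κ u y ^ 2 ≤ 1 := by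
    rw [lintegral_energyDensity_sq hu, hκ2]
    exact ENNReal.ofReal_le_one.2 hle
  set T := π * (π / (2 * κ)) ^ 2 with hT
  have hT0 : 0 < T := by positivity
  have hTμ : T * Real.exp 1 / (8 * π) = π ^ 2 * Real.exp 1 / 32 / μ := by
    rw [hT, ← hκ2]; field_simp; norm_num
  set σ : ℕ → ℝ := fun n => rearrLevel u (T * Real.exp (-n))
  have hσ0 : ∀ n, 0 ≤ σ n := fun n => rearrLevel_nonneg _ _
  have hm : ∀ n, volume {x | σ n < |u x|} ≤ ENNReal.ofReal (T * Real.exp (-n)) := fun n =>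
    measure_superlevel_rearrLevel_le (rearrLevel_set_nonempty hκ hu hE n.cast_nonneg)
  have hpair : ∀ n m : ℕ, 0 < σ n → 0 < σ m → 4 * π * (σ n + σ m) ^ 2 ≤ 3 * n + m + 40 :=
    fun n m hn hm => rearrLevel_pair_bound hκ hu hE n.cast_nonneg m.cast_nonneg hn hm
  have hsingle : ∀ n : ℕ, 4 * π * σ n ^ 2 ≤ n + 10 := by
    intro n
    rcases (hσ0 n).eq_or_lt with h | h
    · rw [← h]; norm_num; positivity
    · have := hpair n n h h
      rw [← two_mul, mul_pow] at this
      linarith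
  have h4 : √(4 * π) ^ 2 = 4 * π := Real.sq_sqrt (by positivity)
  have h4pos : 0 < √(4 * π) := Real.sqrt_pos.2 (by positivity)
  have hS := hsum (fun n => √(4 * π) * σ n) (fun n => mul_nonneg h4pos.le (hσ0 n))
    (fun n => by rw [mul_pow, h4]; exact hsingle n)
    (fun n m _ hn hm => by
      rw [← mul_add, mul_pow, h4]
      exact hpair n m (pos_of_mul_pos_right hn h4pos.le) (pos_of_mul_pos_right hm h4pos.le))
  simp only [mul_pow, h4] at hS
  have hlim : Filter.Tendsto (fun n : ℕ => ENNReal.ofReal (T * Real.exp (-n))) Filter.atTop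
      (nhds 0) := by
    have h1 : Filter.Tendsto (fun n : ℕ => T * Real.exp (-n)) Filter.atTop (nhds (T * 0)) :=
      (Real.tendsto_exp_neg_atTop_nhds_zero.comp tendsto_natCast_atTop_atTop).const_mul T
    simpa using ENNReal.tendsto_ofReal h1
  have hu2 : ∫ x, u x ^ 2 ≤ 1 / μ := by
    rw [le_div_iff₀ hμ]
    have : 0 ≤ ∫ x, gradNorm u x ^ 2 := integral_nonneg fun x => by positivity
    linarith
  refine (lintegral_F_le_of_levels hu.1.continuous.measurable (B := 10)
    (by simpa using hsingle 0) hm hlim).trans ?_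
  rw [add_div, ENNReal.ofReal_add (by positivity) (by positivity)]
  refine add_le_add ?_ ?_
  · rw [← ofReal_integral_eq_lintegral_ofReal (hu.2.1.const_mul _)
      (Filter.Eventually.of_forall fun x => by simp only [Pi.zero_apply]; positivity),
      integral_const_mul]
    refine ENNReal.ofReal_le_ofReal ?_
    calc _ ≤ Real.exp 10 / 2 * (1 / μ) := by gcongr
      _ = _ := by ring
  · calc _ = ∑' n : ℕ, ENNReal.ofReal (T * Real.exp 1 / (8 * π)) *
          ENNReal.ofReal (Real.exp (4 * π * σ (n + 1) ^ 2 - ((n + 1 : ℕ) : ℝ))) := by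
          refine tsum_congr fun n => ?_
          rw [← ENNReal.ofReal_mul (by positivity), ← ENNReal.ofReal_mul (by positivity)]
          congr 1
          have : 4 * π * σ (n + 1) ^ 2 - ((n + 1 : ℕ) : ℝ) =
              4 * π * σ (n + 1) ^ 2 + -n + -1 := by push_cast; ring
          rw [this, Real.exp_add, Real.exp_add, Real.exp_neg 1]
          field_simp
      _ ≤ ENNReal.ofReal (T * Real.exp 1 / (8 * π)) * ENNReal.ofReal C := by
          rw [ENNReal.tsum_mul_left]
          refine mul_le_mul' le_rfl (le_trans ?_ hS)
          exact ENNReal.tsum_comp_le_tsum_of_injective (add_left_injective 1)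
            (fun n : ℕ => ENNReal.ofReal (Real.exp (4 * π * σ n ^ 2 - n)))
      _ = _ := by
          rw [← ENNReal.ofReal_mul (by positivity), hTμ]
          congr 1
          ring
end
end

section
/- Let A ∈ (1/2,1), δ ∈ (0,1/8), and λ > 2/π satisfy 2πλ(1/4−δ) > 1 and 2πλ(1/4 + δ/2)A² = 1. Then there exists a constant C ≥ 1 such that every real-valued ψ ∈ H¹(ℝ²) that is (1/4−δ)-Hölder continuous and satisfies ‖∇ψ‖²_{L²} + (1/2)‖ψ‖²_{L²} ≤ A² obeys exp( 2π(1+2δ) ‖ψ‖²_{L^∞} ) ≤ C (1 + ‖ψ‖_{C^{1/4−δ}})⁴. -/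
open MeasureTheory Real Classical
open scoped ENNReal RealInnerProductSpace

noncomputable section

/-- The unit vector of the plane at angle `θ`. -/
def rayDir (θ : ℝ) : Plane :=
  Complex.orthonormalBasisOneI.repr
    ((Real.cos θ : ℂ) + (Real.sin θ : ℂ) * Complex.I)

lemma norm_rayDir (θ : ℝ) : ‖rayDir θ‖ = 1 := by
  rw [rayDir, LinearIsometryEquiv.norm_map, Complex.ofReal_cos, Complex.ofReal_sin,
    Complex.norm_cos_add_sin_mul_I]

lemma measurable_rayDir : Measurable rayDir := by
  unfold rayDir
  exact (Complex.orthonormalBasisOneI.repr.continuous.comp (by fun_prop)).measurable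

/-- Integration in polar coordinates centred at `x₀`. -/
lemma lintegral_polar (x₀ : Plane) {g : Plane → ℝ≥0∞} (hg : Measurable g) :
    ∫⁻ θ in Set.Ioo (-π) π, ∫⁻ r in Set.Ioi (0 : ℝ),
      ENNReal.ofReal r * g (x₀ + r • rayDir θ) = ∫⁻ x, g x := by
  have hpolar : ∀ p : ℝ × ℝ,
      Complex.orthonormalBasisOneI.repr (Complex.polarCoord.symm p) = p.1 • rayDir p.2 := by
    intro p
    rw [Complex.polarCoord_symm_apply, rayDir, ← map_smul, Complex.real_smul]
  have hmeas : Measurable fun p : ℝ × ℝ =>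
      ENNReal.ofReal p.1 * g (x₀ + p.1 • rayDir p.2) := by
    have := measurable_rayDir
    fun_prop
  calc _ = ∫⁻ p in polarCoord.target, ENNReal.ofReal p.1 * g (x₀ + p.1 • rayDir p.2) := by
        rw [polarCoord_target, Measure.volume_eq_prod, ← Measure.prod_restrict,
          lintegral_prod_symm _ hmeas.aemeasurable]
    _ = ∫⁻ z : ℂ, g (x₀ + Complex.orthonormalBasisOneI.repr z) := by
        rw [← Complex.lintegral_comp_polarCoord_symm]
        simp only [hpolar, smul_eq_mul]
    _ = ∫⁻ x, g (x₀ + x) :=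
        Complex.orthonormalBasisOneI.measurePreserving_repr.lintegral_comp
          (f := fun x => g (x₀ + x)) (by fun_prop)
    _ = ∫⁻ x, g x := lintegral_add_left_eq_self g x₀

/-- Weighted one-dimensional estimate: the increment of `h` is controlled by the
energy `∫ r g² dr` and by `∫ dr / r`. -/
lemma sub_le_weighted_energy {h h' g : ℝ → ℝ} (hd : ∀ r, HasDerivAt h (h' r) r)
    (hg : Measurable g) (hb : ∀ r, |h' r| ≤ g r) {a b s : ℝ} (ha : 0 < a) (hab : a ≤ b)
    (hs : 0 < s)
    (hfin : ∫⁻ r in Set.Ioi (0 : ℝ), ENNReal.ofReal r * ENNReal.ofReal (g r ^ 2) ≠ ⊤) :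
    h b - h a ≤ s / 2 *
      (∫⁻ r in Set.Ioi (0 : ℝ), ENNReal.ofReal r * ENNReal.ofReal (g r ^ 2)).toReal +
        Real.log (b / a) / (2 * s) := by
  have hnn : ∀ r ∈ Set.Ioi (0 : ℝ), 0 ≤ r * g r ^ 2 := fun r hr =>
    mul_nonneg (le_of_lt hr) (sq_nonneg _)
  have heq : ∫⁻ r in Set.Ioi (0 : ℝ), ENNReal.ofReal r * ENNReal.ofReal (g r ^ 2) =
      ∫⁻ r in Set.Ioi (0 : ℝ), ENNReal.ofReal (r * g r ^ 2) :=
    setLIntegral_congr_fun measurableSet_Ioi fun r hr =>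
      (ENNReal.ofReal_mul (le_of_lt hr)).symm
  rw [heq] at hfin ⊢
  have hae : 0 ≤ᵐ[volume.restrict (Set.Ioi (0 : ℝ))] fun r => r * g r ^ 2 :=
    (ae_restrict_mem measurableSet_Ioi).mono hnn
  have hmeas : Measurable fun r => r * g r ^ 2 := by fun_prop
  have hint : IntegrableOn (fun r => r * g r ^ 2) (Set.Ioi 0) :=
    (lintegral_ofReal_ne_top_iff_integrable hmeas.aestronglyMeasurable hae).1 hfin
  rw [← integral_eq_lintegral_of_nonneg_ae hae hmeas.aestronglyMeasurable]
  have hsub : Set.Icc a b ⊆ Set.Ioi 0 := fun r hr => ha.trans_le hr.1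
  have hI1 : IntegrableOn (fun r => s / 2 * (r * g r ^ 2)) (Set.Icc a b) :=
    (hint.mono_set hsub).const_mul _
  have hI2 : IntegrableOn (fun r : ℝ => 1 / (2 * s) * r⁻¹) (Set.Icc a b) :=
    (continuousOn_const.mul (continuousOn_inv₀.mono
      fun r hr => (hsub hr).ne')).integrableOn_Icc
  have key := intervalIntegral.sub_le_integral_of_hasDeriv_right_of_le hab
    (fun r _ => (hd r).continuousAt.continuousWithinAt)
    (fun r _ => (hd r).hasDerivWithinAt) (hI1.add hI2) (fun r hr => by
      have hr0 : 0 < r := ha.trans hr.1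
      have h1 : h' r ≤ g r := (le_abs_self _).trans (hb r)
      refine h1.trans ?_
      have : s / 2 * (r * g r ^ 2) + 1 / (2 * s) * r⁻¹ - g r =
          (s * r * g r - 1) ^ 2 / (2 * s * r) := by
        field_simp
        ring
      have h2 : 0 ≤ (s * r * g r - 1) ^ 2 / (2 * s * r) := by positivity
      simp only [Pi.add_apply]
      linarith)
  refine key.trans ?_
  simp only [Pi.add_apply]
  rw [intervalIntegral.integral_add
      ((intervalIntegrable_iff_integrableOn_Icc_of_le hab).2 hI1)
      ((intervalIntegrable_iff_integrableOn_Icc_of_le hab).2 hI2),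
    intervalIntegral.integral_const_mul, intervalIntegral.integral_const_mul,
    integral_inv_of_pos ha (ha.trans_le hab)]
  have hle : ∫ r in a..b, r * g r ^ 2 ≤ ∫ r in Set.Ioi (0 : ℝ), r * g r ^ 2 := by
    rw [intervalIntegral.integral_of_le hab]
    exact setIntegral_mono_set hint hae
      (Set.Ioc_subset_Icc_self.trans hsub).eventuallyLE
  have := mul_le_mul_of_nonneg_left hle (by positivity : 0 ≤ s / 2)
  have h3 : 1 / (2 * s) * Real.log (b / a) = Real.log (b / a) / (2 * s) := by ring
  linarith

/-- Absolute-value form of `sub_le_weighted_energy`. -/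
lemma abs_le_add_weighted_energy {h h' g : ℝ → ℝ} (hd : ∀ r, HasDerivAt h (h' r) r)
    (hg : Measurable g) (hb : ∀ r, |h' r| ≤ g r) {a b s : ℝ} (ha : 0 < a) (hab : a ≤ b)
    (hs : 0 < s)
    (hfin : ∫⁻ r in Set.Ioi (0 : ℝ), ENNReal.ofReal r * ENNReal.ofReal (g r ^ 2) ≠ ⊤) :
    |h a| ≤ |h b| + (s / 2 *
      (∫⁻ r in Set.Ioi (0 : ℝ), ENNReal.ofReal r * ENNReal.ofReal (g r ^ 2)).toReal +
        Real.log (b / a) / (2 * s)) := by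
  have h1 := sub_le_weighted_energy hd hg hb ha hab hs hfin
  have h2 := sub_le_weighted_energy (h := fun r => -h r) (h' := fun r => -h' r)
    (fun r => (hd r).neg) hg (fun r => (abs_neg (h' r)).trans_le (hb r)) ha hab hs hfin
  rcases abs_cases (h a) with h3 | h3
  · linarith [le_abs_self (h b)]
  · linarith [neg_abs_le (h b)]

/-- Pointwise estimate at logarithmic scale, from averaging along rays. -/
lemma abs_le_of_energy {ψ : Plane → ℝ} (hψ : MemH1 ψ) {E : ℝ}
    (hE : (∫ x, gradNorm ψ x ^ 2) + (1 / 2) * (∫ x, ψ x ^ 2) ≤ E)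
    {x₀ : Plane} {a s : ℝ} (ha : 0 < a) (ha1 : a ≤ 1) (hs : 0 < s)
    (hosc : ∀ y, ‖y - x₀‖ = a → |ψ x₀ - ψ y| ≤ 1) :
    |ψ x₀| ≤ 3 / 2 + E / π + s * E / (4 * π) + Real.log (2 / a) / (2 * s) := by
  obtain ⟨hdiff, hi0, hi1⟩ := hψ
  have hgm : Measurable (gradNorm ψ) := (measurable_fderiv ℝ ψ).norm
  have hψm : Measurable ψ := hdiff.continuous.measurable
  set G : ℝ → ℝ≥0∞ := fun θ => ∫⁻ r in Set.Ioi (0 : ℝ),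
    ENNReal.ofReal r * ENNReal.ofReal (gradNorm ψ (x₀ + r • rayDir θ) ^ 2) with hG
  set c : ℝ := |ψ x₀| - 3 / 2 - Real.log (2 / a) / (2 * s) with hc
  have hray : ∀ θ, ∀ R ∈ Set.Ioo (1 : ℝ) 2, ENNReal.ofReal c ≤
      ENNReal.ofReal R * ENNReal.ofReal (ψ (x₀ + R • rayDir θ) ^ 2) +
        ENNReal.ofReal (s / 2) * G θ := by
    intro θ R hR
    by_cases hfin : G θ = ⊤
    · rw [hfin, ENNReal.mul_top (by simpa using hs)]
      simp
    have hline : ∀ r : ℝ, HasDerivAt (fun r : ℝ => ψ (x₀ + r • rayDir θ))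
        (fderiv ℝ ψ (x₀ + r • rayDir θ) (rayDir θ)) r := by
      intro r
      have h1 : HasDerivAt (fun r : ℝ => x₀ + r • rayDir θ) (rayDir θ) r := by
        simpa using ((hasDerivAt_id r).smul_const (rayDir θ)).const_add x₀
      exact (hdiff _).hasFDerivAt.comp_hasDerivAt r h1
    have hle := abs_le_add_weighted_energy (g := fun r => gradNorm ψ (x₀ + r • rayDir θ))
      hline (by fun_prop) (fun r => by
        have := (fderiv ℝ ψ (x₀ + r • rayDir θ)).le_opNorm (rayDir θ)
        rwa [norm_rayDir, mul_one] at this) ha (ha1.trans hR.1.le) hs hfin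
    have hlog : Real.log (R / a) / (2 * s) ≤ Real.log (2 / a) / (2 * s) := by
      have : 0 < R := zero_lt_one.trans hR.1
      gcongr
      exact hR.2.le
    have hx := hosc (x₀ + a • rayDir θ) (by
      rw [add_sub_cancel_left, norm_smul, norm_rayDir, mul_one, Real.norm_of_nonneg ha.le])
    have htri := abs_sub_abs_le_abs_sub (ψ x₀) (ψ (x₀ + a • rayDir θ))
    have hc' : c ≤ R * ψ (x₀ + R • rayDir θ) ^ 2 + s / 2 * (G θ).toReal := by
      have h1 := sq_nonneg (|ψ (x₀ + R • rayDir θ)| - 1)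
      have h2 := sq_abs (ψ (x₀ + R • rayDir θ))
      have h3 : ψ (x₀ + R • rayDir θ) ^ 2 ≤ R * ψ (x₀ + R • rayDir θ) ^ 2 :=
        le_mul_of_one_le_left (sq_nonneg _) hR.1.le
      have h4 := sq_nonneg (ψ (x₀ + R • rayDir θ))
      simp only [hG] at *
      nlinarith
    calc ENNReal.ofReal c ≤ _ := ENNReal.ofReal_le_ofReal hc'
      _ ≤ _ := ENNReal.ofReal_add_le
      _ = _ := by
        rw [ENNReal.ofReal_mul (zero_le_one.trans hR.1.le), ENNReal.ofReal_mul (by positivity),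
          ENNReal.ofReal_toReal hfin]
  set H : ℝ → ℝ≥0∞ := fun θ => ∫⁻ r in Set.Ioi (0 : ℝ),
    ENNReal.ofReal r * ENNReal.ofReal (ψ (x₀ + r • rayDir θ) ^ 2) with hH
  have hmeasψ : Measurable fun x => ENNReal.ofReal (ψ x ^ 2) := by fun_prop
  have hmeasg : Measurable fun x => ENNReal.ofReal (gradNorm ψ x ^ 2) := by fun_prop
  have hHm : Measurable H := by
    have h := measurable_rayDir
    have : Measurable (Function.uncurry fun θ r : ℝ =>
      ENNReal.ofReal r * ENNReal.ofReal (ψ (x₀ + r • rayDir θ) ^ 2)) := by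
      unfold Function.uncurry
      fun_prop
    exact this.lintegral_prod_right
  have hang : ∀ θ, ENNReal.ofReal c ≤ H θ + ENNReal.ofReal (s / 2) * G θ := by
    intro θ
    have h1 := setLIntegral_mono' (μ := volume) measurableSet_Ioo (hray θ)
    rw [lintegral_add_right _ measurable_const, setLIntegral_const, setLIntegral_const,
      Real.volume_Ioo] at h1
    norm_num at h1
    refine h1.trans (add_le_add_left (lintegral_mono_set fun r hr => ?_) _)
    exact zero_lt_one.trans hr.1
  have h2 := lintegral_mono (μ := volume.restrict (Set.Ioo (-π) π)) hang
  rw [lintegral_add_left hHm, lintegral_const_mul' _ _ ENNReal.ofReal_ne_top,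
    setLIntegral_const, Real.volume_Ioo, hH, hG, lintegral_polar x₀ hmeasψ,
    lintegral_polar x₀ hmeasg,
    ← ofReal_integral_eq_lintegral_ofReal hi0 (ae_of_all _ fun x => sq_nonneg _),
    ← ofReal_integral_eq_lintegral_ofReal hi1 (ae_of_all _ fun x => sq_nonneg _),
    ← ENNReal.ofReal_mul (p := s / 2) (by positivity),
    ← ENNReal.ofReal_mul' (q := π - -π) (by linarith [pi_pos])] at h2
  have hn0 : 0 ≤ ∫ x, ψ x ^ 2 := integral_nonneg fun x => sq_nonneg _
  have hn1 : 0 ≤ ∫ x, gradNorm ψ x ^ 2 := integral_nonneg fun x => sq_nonneg _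
  rw [← ENNReal.ofReal_add hn0 (by positivity),
    ENNReal.ofReal_le_ofReal_iff (by positivity)] at h2
  have h3 : s / 2 * ∫ x, gradNorm ψ x ^ 2 ≤ s / 2 * E := by
    gcongr
    linarith
  have h4 : c ≤ (2 * E + s / 2 * E) / (2 * π) := by
    rw [le_div_iff₀ (by positivity)]
    linarith
  have h5 : (2 * E + s / 2 * E) / (2 * π) = E / π + s * E / (4 * π) := by
    field_simp
    ring
  linarith

lemma holderSemi_nonneg (α : ℝ) (u : Plane → ℝ) : 0 ≤ holderSemi α u :=
  Real.iSup_nonneg fun p => by split_ifs <;> positivity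

lemma holderNorm_nonneg (α : ℝ) (u : Plane → ℝ) : 0 ≤ holderNorm α u :=
  add_nonneg (Real.iSup_nonneg fun _ => abs_nonneg _) (holderSemi_nonneg α u)

lemma IsHolder.abs_sub_le {α : ℝ} {u : Plane → ℝ} (hu : IsHolder α u) (x y : Plane) :
    |u x - u y| ≤ holderNorm α u * ‖x - y‖ ^ α := by
  obtain ⟨C, hC, h⟩ := hu
  by_cases hxy : x = y
  · subst hxy
    simpa using mul_nonneg (holderNorm_nonneg α u) (by positivity)
  have hpos : ∀ {p q : Plane}, p ≠ q → 0 < ‖p - q‖ ^ α := fun hpq =>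
    Real.rpow_pos_of_pos (norm_pos_iff.2 (sub_ne_zero.2 hpq)) _
  have hbdd : BddAbove (Set.range fun p : Plane × Plane =>
      if p.1 = p.2 then 0 else |u p.1 - u p.2| / ‖p.1 - p.2‖ ^ α) := by
    refine ⟨C, ?_⟩
    rintro _ ⟨p, rfl⟩
    dsimp only
    split_ifs with hp
    · exact hC
    · exact (div_le_iff₀ (hpos hp)).2 (h _ _)
  have hle := le_ciSup hbdd (x, y)
  simp only [if_neg hxy] at hle
  rw [div_le_iff₀ (hpos hxy)] at hle
  refine hle.trans (mul_le_mul_of_nonneg_right ?_ (hpos hxy).le)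
  exact le_add_of_nonneg_left (Real.iSup_nonneg fun _ => abs_nonneg _)

/-- Logarithmic inequality: up to a linear term, `|ψ|²` is bounded by the energy times the
logarithm of the Hölder norm, with the sharp
constant `1 / (2πα)`. -/
lemma sq_le_log_holderNorm {ψ : Plane → ℝ} (hψ : MemH1 ψ) {α E : ℝ} (hα : 0 < α)
    (hH : IsHolder α ψ) (hE0 : 0 < E) (hE1 : E ≤ 1)
    (hE : (∫ x, gradNorm ψ x ^ 2) + (1 / 2) * (∫ x, ψ x ^ 2) ≤ E) (x : Plane) :
    |ψ x| ^ 2 ≤ 5 * |ψ x| +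
      (Real.log 2 + Real.log (1 + holderNorm α ψ) / α) * E / (2 * π) := by
  set N := holderNorm α ψ
  have hN : 0 ≤ N := holderNorm_nonneg α ψ
  have hℓ : 0 ≤ Real.log (1 + N) := Real.log_nonneg (by linarith)
  have hlog2 : 0 < Real.log 2 := Real.log_pos one_lt_two
  rcases (abs_nonneg (ψ x)).eq_or_lt with h0 | hM
  · rw [← h0]
    norm_num
    positivity
  set M := |ψ x|
  have ha : 0 < (1 + N) ^ (-1 / α) := Real.rpow_pos_of_pos (by linarith) _
  have ha1 : (1 + N) ^ (-1 / α) ≤ 1 :=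
    Real.rpow_le_one_of_one_le_of_nonpos (by linarith)
      (div_nonpos_of_nonpos_of_nonneg (by norm_num) hα.le)
  have haα : ((1 + N) ^ (-1 / α)) ^ α = (1 + N)⁻¹ := by
    rw [← Real.rpow_mul (by linarith), div_mul_cancel₀ _ hα.ne', Real.rpow_neg_one]
  have hlog : Real.log (2 / (1 + N) ^ (-1 / α)) = Real.log 2 + Real.log (1 + N) / α := by
    rw [Real.log_div two_ne_zero ha.ne', Real.log_rpow (by linarith)]
    ring
  have hs : 0 < 2 * π * M / E := by positivity
  have key := abs_le_of_energy hψ hE (x₀ := x) ha ha1 hs (fun y hy => by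
    refine (hH.abs_sub_le x y).trans ?_
    rw [norm_sub_rev, hy, haα, ← div_eq_mul_inv]
    exact (div_le_one (by linarith)).2 (by linarith))
  rw [hlog] at key
  change M ≤ _ at key
  have hEπ : E / π ≤ 1 := (div_le_one pi_pos).2 (by linarith [pi_gt_three])
  set L := Real.log 2 + Real.log (1 + N) / α
  have e1 : 2 * π * M / E * E / (4 * π) = M / 2 := by
    field_simp
    ring
  have e2 : L / (2 * (2 * π * M / E)) = L * E / (2 * π) / 2 / M := by
    field_simp
  rw [e1, e2] at key
  have key2 : M / 2 - 5 / 2 ≤ L * E / (2 * π) / 2 / M := by linarith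
  rw [le_div_iff₀ hM] at key2
  linarith

/-- exponential bound via the logarithmic inequality
(the key estimate in the proof of Lemma 3.1). -/
theorem statement12 (A δ lam : ℝ) (hA : A ∈ Set.Ioo (1/2 : ℝ) 1)
    (hδ : δ ∈ Set.Ioo (0:ℝ) (1/8)) (hlam : 2 / π < lam)
    (h1 : 1 < 2 * π * lam * (1/4 - δ))
    (h2 : 2 * π * lam * (1/4 + δ/2) * A ^ 2 = 1) :
    ∃ C : ℝ, 1 ≤ C ∧ ∀ ψ : Plane → ℝ, MemH1 ψ → IsHolder (1/4 - δ) ψ →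
      (∫ x : Plane, gradNorm ψ x ^ 2) + (1/2) * (∫ x : Plane, ψ x ^ 2) ≤ A ^ 2 →
      Real.exp (2 * π * (1 + 2 * δ) * supNorm ψ ^ 2) ≤
        C * (1 + holderNorm (1/4 - δ) ψ) ^ 4 := by
  obtain ⟨hA0, hA1⟩ := hA
  obtain ⟨hδ0, hδ1⟩ := hδ
  set α := 1 / 4 - δ with hαdef
  have hα : 0 < α := by linarith
  have hE0 : 0 < A ^ 2 := by positivity
  have hE1 : A ^ 2 ≤ 1 := by nlinarith
  have hπ := pi_pos
  obtain ⟨κ, hκ⟩ : ∃ κ, κ = (1 + 2 * δ) * A ^ 2 / α := ⟨_, rfl⟩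
  have hκ0 : 0 < κ := by rw [hκ]; positivity
  have hκ4 : κ < 4 := by
    rw [hκ, div_lt_iff₀ hα]
    have h3 := mul_lt_mul_of_pos_right h1 (by positivity : 0 < (1 / 4 + δ / 2) * A ^ 2)
    have h4 : 2 * π * lam * α * ((1 / 4 + δ / 2) * A ^ 2) = α := by
      linear_combination α * h2
    linarith
  set B : ℝ := 4 / κ * (2 * π * (1 + 2 * δ) * (25 / (4 - κ)) +
    (1 + 2 * δ) * A ^ 2 * Real.log 2) with hB
  have hlog2 : 0 < Real.log 2 := Real.log_pos one_lt_two
  have hκ' : 0 < 4 - κ := by linarith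
  have hB0 : 0 ≤ B := by positivity
  refine ⟨Real.exp B, Real.one_le_exp hB0, fun ψ hψ hH hE => ?_⟩
  have hN := holderNorm_nonneg α ψ
  set ℓ := Real.log (1 + holderNorm α ψ) with hℓ
  have hℓ0 : 0 ≤ ℓ := Real.log_nonneg (by linarith)
  have hw : 0 < 2 * π * (1 + 2 * δ) := by positivity
  have hpt : ∀ x, |ψ x| ≤ √((B + 4 * ℓ) / (2 * π * (1 + 2 * δ))) := by
    intro x
    refine Real.le_sqrt_of_sq_le ((le_div_iff₀ hw).2 ?_)
    have hlin := sq_le_log_holderNorm hψ hα hH hE0 hE1 hE x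
    rw [← hℓ] at hlin
    set M := |ψ x|
    have hyoung : 5 * M ≤ (1 - κ / 4) * M ^ 2 + 25 / (4 - κ) := by
      have : (1 - κ / 4) * M ^ 2 + 25 / (4 - κ) - 5 * M =
          ((4 - κ) * M - 10) ^ 2 / (4 * (4 - κ)) := by
        field_simp
        ring
      have h5 : 0 ≤ ((4 - κ) * M - 10) ^ 2 / (4 * (4 - κ)) := by positivity
      linarith
    have h6 : κ / 4 * M ^ 2 ≤ 25 / (4 - κ) + (Real.log 2 + ℓ / α) * A ^ 2 / (2 * π) := by
      linarith
    have h7 := mul_le_mul_of_nonneg_left h6 (by positivity : 0 ≤ 4 / κ * (2 * π * (1 + 2 * δ)))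
    have e1 : 4 / κ * (2 * π * (1 + 2 * δ)) * (κ / 4 * M ^ 2) =
        M ^ 2 * (2 * π * (1 + 2 * δ)) := by
      field_simp
    have e2 : 4 / κ * (2 * π * (1 + 2 * δ)) *
        (25 / (4 - κ) + (Real.log 2 + ℓ / α) * A ^ 2 / (2 * π)) =
        B + 4 / κ * ((1 + 2 * δ) * A ^ 2 / α) * ℓ := by
      rw [hB]
      field_simp
      ring
    rw [e1, e2, ← hκ, div_mul_cancel₀ _ hκ0.ne'] at h7
    exact h7
  have hsup0 : 0 ≤ supNorm ψ := Real.iSup_nonneg fun _ => abs_nonneg _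
  have hsup : supNorm ψ ^ 2 ≤ (B + 4 * ℓ) / (2 * π * (1 + 2 * δ)) :=
    (Real.le_sqrt hsup0 (by positivity)).1 (ciSup_le hpt)
  rw [le_div_iff₀ hw] at hsup
  calc Real.exp (2 * π * (1 + 2 * δ) * supNorm ψ ^ 2) ≤ Real.exp (B + 4 * ℓ) :=
        Real.exp_le_exp.2 (by linarith)
    _ = Real.exp B * (1 + holderNorm α ψ) ^ 4 := by
        have h8 : Real.exp (4 * ℓ) = Real.exp ℓ ^ 4 := by
          rw [← Real.exp_nat_mul]
          norm_num
        rw [Real.exp_add, h8, hℓ, Real.exp_log (by linarith)]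
end
end
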